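/- Let ω be a subadditive weight function. Let A ≠ 0 be a real number, a ∈ [0,1), and let θ:ℝ→ℝ be a smooth function with θ′ ∈ B_{L∞,ω}(ℝ), |θ(x)| = O(|x|^a) as |x|→∞, and ω(x^a) = o(ω(x)) as x→∞. Set ψ(x) = Ax + θ(x). Then for every f ∈ S_ω(ℝ) the composition f∘ψ belongs to S_ω(ℝ); that is, the composition operator C_ψ : S_ω(ℝ) → S_ω(ℝ) is well defined. -/

import Mathlib

open MeasureTheory

/-- A subadditive weight function in the sense of Braun–Meise–Taylor. -/
structure IsWeightFunction (ω : ℝ → ℝ) : Prop where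
  continuous : Continuous ω
  monotone : MonotoneOn ω (Set.Ici 0)
  nonneg : ∀ t : ℝ, 0 ≤ t → 0 ≤ ω t
  subadditive : ∀ s t : ℝ, 0 ≤ s → 0 ≤ t → ω (s + t) ≤ ω s + ω t
  integral : IntegrableOn (fun t : ℝ => ω t / (1 + t ^ 2)) (Set.Ioi 0)
  growth : (fun t : ℝ => Real.log (1 + t ^ 2)) =o[Filter.atTop] ω
  convex : ConvexOn ℝ Set.univ fun t : ℝ => ω (Real.exp t)

/-- The Young conjugate `φ*_ω(s) = sup_{t ≥ 0} (s·t − ω(eᵗ))`. -/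
noncomputable def youngConj (ω : ℝ → ℝ) (s : ℝ) : ℝ :=
  sSup ((fun t : ℝ => s * t - ω (Real.exp t)) '' Set.Ici 0)

/-- Membership in the Gelfand–Shilov space `S_ω(ℝ)`. -/
def InSomega (ω : ℝ → ℝ) (f : ℝ → ℂ) : Prop :=
  ContDiff ℝ (⊤ : ℕ∞) f ∧ ∀ lam > (0 : ℝ), ∀ mu > (0 : ℝ), ∃ C : ℝ, ∀ (k : ℕ) (x : ℝ),
    ‖iteratedDeriv k f x‖ ≤
      C * Real.exp (lam * youngConj ω ((k : ℝ) / lam) - mu * ω |x|)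

/-- The weight sequence `exp (l φ*_ω(k / l))` attached to a weight function. -/
noncomputable def weightSeq (ω : ℝ → ℝ) (l : ℝ) (k : ℕ) : ℝ :=
  Real.exp (l * youngConj ω ((k : ℝ) / l))

lemma weightSeq_pos (ω : ℝ → ℝ) (l : ℝ) (k : ℕ) : 0 < weightSeq ω l k := Real.exp_pos _

lemma IsWeightFunction.natCast_mul_le {ω : ℝ → ℝ} (hω : IsWeightFunction ω) {n : ℕ} (hn : 1 ≤ n)
    {r : ℝ} (hr : 0 ≤ r) : ω (n * r) ≤ n * ω r := by
  induction n, hn using Nat.le_induction with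
  | base => simp
  | succ n _ ih =>
    have h := hω.subadditive (n * r) r (by positivity) hr
    push_cast
    rw [add_mul, one_mul, add_mul, one_mul]
    linarith

/-- Since `log t = o(ω(t))`, every multiple of `t` is dominated by `ω(eᵗ)` up to a constant. -/
lemma IsWeightFunction.exists_linear_le {ω : ℝ → ℝ} (hω : IsWeightFunction ω) (s : ℝ) (hs : 0 < s) :
    ∃ K : ℝ, ∀ t : ℝ, 0 ≤ t → s * t - ω (Real.exp t) ≤ K := by
  have h1 := hω.growth.def (show 0 < 1 / s by positivity)
  obtain ⟨R, hR⟩ := Filter.eventually_atTop.1 h1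
  refine ⟨s * |R|, fun t ht => ?_⟩
  have hωt := hω.nonneg (Real.exp t) (Real.exp_pos t).le
  have hsR : 0 ≤ s * |R| := by positivity
  by_cases hc : R ≤ Real.exp t
  · have h2 := hR _ hc
    rw [Real.norm_of_nonneg hωt, Real.norm_of_nonneg
      (Real.log_nonneg (by nlinarith [sq_nonneg (Real.exp t)]))] at h2
    have h3 : t ≤ Real.log (1 + Real.exp t ^ 2) := by
      rw [Real.le_log_iff_exp_le (by positivity)]
      nlinarith [sq_nonneg (Real.exp t - 1), Real.exp_pos t]
    have h4 : t ≤ 1 / s * ω (Real.exp t) := h3.trans h2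
    have h5 : s * t ≤ ω (Real.exp t) := by
      have := mul_le_mul_of_nonneg_left h4 hs.le
      rwa [← mul_assoc, mul_one_div_cancel hs.ne', one_mul] at this
    linarith
  · have h2 : t ≤ |R| := by
      have := Real.add_one_le_exp t
      have := le_abs_self R
      linarith
    have := mul_le_mul_of_nonneg_left h2 hs.le
    linarith

lemma IsWeightFunction.bddAbove {ω : ℝ → ℝ} (hω : IsWeightFunction ω) (s : ℝ) :
    BddAbove ((fun t : ℝ => s * t - ω (Real.exp t)) '' Set.Ici 0) := by
  obtain ⟨K, hK⟩ := hω.exists_linear_le (|s| + 1) (by positivity)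
  refine ⟨K, ?_⟩
  rintro _ ⟨t, ht, rfl⟩
  have h1 := hK t ht
  have h2 : s * t ≤ (|s| + 1) * t :=
    mul_le_mul_of_nonneg_right (by linarith [le_abs_self s]) ht
  simp only
  linarith

lemma IsWeightFunction.pow_mul_exp_le {ω : ℝ → ℝ} (hω : IsWeightFunction ω) {l : ℝ} (hl : 0 < l)
    (k : ℕ) {r : ℝ} (hr : 1 ≤ r) : r ^ k * Real.exp (-(l * ω r)) ≤ weightSeq ω l k := by
  have hr0 : 0 < r := by linarith
  have h := le_csSup (hω.bddAbove (k / l)) ⟨Real.log r, Real.log_nonneg hr, rfl⟩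
  simp only [Real.exp_log hr0] at h
  have h2 := mul_le_mul_of_nonneg_left h hl.le
  have e : r ^ k * Real.exp (-(l * ω r)) = Real.exp (l * (k / l * Real.log r - ω r)) := by
    rw [show l * (k / l * Real.log r - ω r) = k * Real.log r + -(l * ω r) by field_simp; ring,
      Real.exp_add, Real.exp_nat_mul, Real.exp_log hr0]
  rw [e]
  exact Real.exp_le_exp.2 h2

lemma weightSeq_le {ω : ℝ → ℝ} {l : ℝ} (hl : 0 < l) {k : ℕ} {b : ℝ}
    (h : ∀ r : ℝ, 1 ≤ r → r ^ k * Real.exp (-(l * ω r)) ≤ b) : weightSeq ω l k ≤ b := by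
  have hb : 0 < b := lt_of_lt_of_le (by positivity) (h 1 le_rfl)
  rw [weightSeq, ← Real.le_log_iff_exp_le hb, mul_comm, ← le_div_iff₀ hl]
  refine csSup_le (Set.Nonempty.image _ ⟨0, le_refl (0 : ℝ)⟩) ?_
  rintro _ ⟨t, ht, rfl⟩
  have h1 := h (Real.exp t) (Real.one_le_exp ht)
  rw [← Real.exp_nat_mul, ← Real.exp_add, ← Real.le_log_iff_exp_le hb] at h1
  rw [le_div_iff₀ hl]
  refine le_trans (le_of_eq ?_) h1
  field_simp
  ring

lemma IsWeightFunction.choose_mul_weightSeq_le {ω : ℝ → ℝ} (hω : IsWeightFunction ω) {l : ℝ}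
    (hl : 0 < l) (i j : ℕ) :
    ((i + j).choose i : ℝ) * (weightSeq ω l i * weightSeq ω l j) ≤ weightSeq ω l (i + j) := by
  have hc : (0 : ℝ) < (i + j).choose i := by exact_mod_cast Nat.choose_pos (Nat.le_add_right i j)
  rw [← mul_assoc, mul_comm, ← le_div_iff₀ (by have := weightSeq_pos ω l i; positivity)]
  refine weightSeq_le hl fun s hs => ?_
  rw [le_div_iff₀ (by have := weightSeq_pos ω l i; positivity), ← mul_assoc, mul_comm,
    ← le_div_iff₀ (by positivity)]
  refine weightSeq_le hl fun r hr => ?_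
  rw [le_div_iff₀ (by positivity)]
  refine le_trans ?_ (hω.pow_mul_exp_le hl (i + j) (r := r + s) (by linarith))
  have h1 : ((i + j).choose i : ℝ) * (r ^ i * s ^ j) ≤ (r + s) ^ (i + j) := by
    rw [add_pow]
    refine le_trans (le_of_eq ?_) (Finset.single_le_sum (f := fun m =>
      r ^ m * s ^ (i + j - m) * ((i + j).choose m : ℝ)) (fun m _ => by positivity)
      (Finset.mem_range.2 (show i < i + j + 1 by omega)))
    simp only [Nat.add_sub_cancel_left]
    ring
  have h2 : Real.exp (-(l * ω r)) * Real.exp (-(l * ω s)) ≤ Real.exp (-(l * ω (r + s))) := by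
    rw [← Real.exp_add]
    have := mul_le_mul_of_nonneg_left (hω.subadditive r s (by linarith) (by linarith)) hl.le
    exact Real.exp_le_exp.2 (by linarith)
  calc _ = ((i + j).choose i : ℝ) * (r ^ i * s ^ j) *
        (Real.exp (-(l * ω r)) * Real.exp (-(l * ω s))) := by ring
    _ ≤ _ := mul_le_mul h1 h2 (by positivity) (by positivity)

lemma IsWeightFunction.pow_mul_weightSeq_le {ω : ℝ → ℝ} (hω : IsWeightFunction ω) {l : ℝ}
    (hl : 0 < l) {n : ℕ} (hn : 1 ≤ n) (k : ℕ) :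
    (n : ℝ) ^ k * weightSeq ω (n * l) k ≤ weightSeq ω l k := by
  have hn' : (1 : ℝ) ≤ n := by exact_mod_cast hn
  rw [mul_comm, ← le_div_iff₀ (by positivity)]
  refine weightSeq_le (by positivity) fun r hr => ?_
  rw [le_div_iff₀ (by positivity)]
  refine le_trans ?_ (hω.pow_mul_exp_le hl k (r := n * r) (by nlinarith))
  rw [mul_right_comm, ← mul_pow, mul_comm r]
  have := mul_le_mul_of_nonneg_left (hω.natCast_mul_le hn (r := r) (by linarith)) hl.le
  exact mul_le_mul_of_nonneg_left (Real.exp_le_exp.2 (by linarith)) (by positivity)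

lemma IsWeightFunction.exists_weightSeq_succ_le {ω : ℝ → ℝ} (hω : IsWeightFunction ω) {l l' : ℝ}
    (hl : 0 < l) (hll' : l + 1 ≤ l') :
    ∃ K > 0, ∀ k : ℕ, weightSeq ω l' (k + 1) ≤ K * weightSeq ω l k := by
  obtain ⟨K, hK⟩ := hω.exists_linear_le 1 one_pos
  refine ⟨Real.exp K, Real.exp_pos K, fun k => weightSeq_le (by linarith) fun r hr => ?_⟩
  have hr0 : 0 < r := by linarith
  have h1 := hK (Real.log r) (Real.log_nonneg hr)
  rw [Real.exp_log hr0] at h1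
  have h2 : r * Real.exp (-ω r) ≤ Real.exp K := by
    nth_rw 1 [← Real.exp_log hr0]
    rw [← Real.exp_add]
    exact Real.exp_le_exp.2 (by linarith)
  have h3 : Real.exp (-(l' * ω r)) ≤ Real.exp (-ω r) * Real.exp (-(l * ω r)) := by
    rw [← Real.exp_add]
    have := mul_le_mul_of_nonneg_right hll' (hω.nonneg r hr0.le)
    exact Real.exp_le_exp.2 (by linarith)
  calc r ^ (k + 1) * Real.exp (-(l' * ω r))
      ≤ r ^ (k + 1) * (Real.exp (-ω r) * Real.exp (-(l * ω r))) := by gcongr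
    _ = (r * Real.exp (-ω r)) * (r ^ k * Real.exp (-(l * ω r))) := by ring
    _ ≤ _ := mul_le_mul h2 (hω.pow_mul_exp_le hl k hr) (by positivity) (by positivity)

/-- A sublinear perturbation of a nonzero linear map is bounded below by a linear function. -/
lemma exists_abs_le_of_sublinear {A a C₀ : ℝ} (hA : A ≠ 0) (ha1 : a < 1)
    (hC₀ : 0 < C₀) {θ : ℝ → ℝ} (hθ : ∀ x : ℝ, |θ x| ≤ C₀ * (1 + |x|) ^ a) :
    ∃ n : ℕ, 1 ≤ n ∧ ∃ K : ℝ, 0 ≤ K ∧ ∀ x : ℝ, |x| ≤ n * |A * x + θ x| + K := by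
  have hA' : 0 < |A| := abs_pos.2 hA
  have ho := (tendsto_rpow_neg_atTop (show 0 < 1 - a by linarith)).eventually_le_const
    (show 0 < |A| / (2 * C₀) by positivity)
  obtain ⟨R, hR⟩ := Filter.eventually_atTop.1 ho
  have key : ∀ y : ℝ, 1 ≤ y → C₀ * y ^ a ≤ |A| / 2 * y + C₀ * |R| := by
    intro y hy
    have hy0 : 0 < y := by linarith
    by_cases hc : R ≤ y
    · have h := mul_le_mul_of_nonneg_right (hR y hc) hy0.le
      rw [← Real.rpow_add_one hy0.ne', show -(1 - a) + 1 = a by ring] at h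
      have h2 := mul_le_mul_of_nonneg_left h hC₀.le
      have e : C₀ * (|A| / (2 * C₀) * y) = |A| / 2 * y := by field_simp
      rw [e] at h2
      have : 0 ≤ C₀ * |R| := by positivity
      linarith
    · have h : y ^ a ≤ y := by
        simpa using Real.rpow_le_rpow_of_exponent_le hy ha1.le
      have h2 : y ^ a ≤ |R| := by linarith [le_abs_self R]
      have h3 := mul_le_mul_of_nonneg_left h2 hC₀.le
      have : 0 ≤ |A| / 2 * y := by positivity
      linarith
  obtain ⟨n, hn⟩ := exists_nat_ge (2 / |A| + 1)
  have hn1 : (1 : ℝ) ≤ n := by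
    have : 0 ≤ 2 / |A| := by positivity
    linarith
  refine ⟨n, by exact_mod_cast hn1, n * (|A| / 2 + C₀ * |R|), by positivity, fun x => ?_⟩
  have h1 := (hθ x).trans (key (1 + |x|) (by linarith [abs_nonneg x]))
  have h2 : |A| * |x| ≤ |A * x + θ x| + |θ x| := by
    rw [← abs_mul]
    calc |A * x| = |(A * x + θ x) - θ x| := by ring_nf
      _ ≤ _ := abs_sub _ _
  have h3 : |x| ≤ 2 / |A| * (|A * x + θ x| + (|A| / 2 + C₀ * |R|)) := by
    rw [div_mul_eq_mul_div, le_div_iff₀ hA']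
    linarith
  refine h3.trans ?_
  rw [← mul_add]
  gcongr
  linarith

/-- A Faà di Bruno type estimate at a point, for a weight sequence `M` with
`(i + j).choose i * M i * M j ≤ M (i + j)`. -/
lemma norm_iteratedDeriv_comp_le_of_weight {f : ℝ → ℂ} {ψ : ℝ → ℝ}
    (hf : ContDiff ℝ (⊤ : ℕ∞) f) (hψ : ContDiff ℝ (⊤ : ℕ∞) ψ) {M : ℕ → ℝ} (hM0 : ∀ k, 0 ≤ M k)
    (hM : ∀ i j : ℕ, ((i + j).choose i : ℝ) * (M i * M j) ≤ M (i + j))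
    {D c x : ℝ} (hD : 0 < D) (hc : 0 ≤ c)
    (hfx : ∀ m, ‖iteratedDeriv m f (ψ x)‖ ≤ c * (D⁻¹ ^ m * M m))
    (hψx : ∀ j, ‖iteratedDeriv (j + 1) ψ x‖ ≤ D * M j) (k m : ℕ) :
    ‖iteratedDeriv k (fun y => iteratedDeriv m f (ψ y)) x‖ ≤
      c * (D⁻¹ ^ m * 2 ^ k * M (m + k)) := by
  induction k using Nat.strong_induction_on generalizing m with
  | _ k ih =>
  cases k with
  | zero => simpa using hfx m
  | succ k =>
    have hfm : ∀ m, ContDiff ℝ (⊤ : ℕ∞) (iteratedDeriv m f) := fun m => by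
      rw [iteratedDeriv_eq_iterate]
      exact hf.iterate_deriv m
    have hder : deriv (fun y => iteratedDeriv m f (ψ y)) =
        fun y => deriv ψ y • iteratedDeriv (m + 1) f (ψ y) := by
      funext y
      rw [iteratedDeriv_succ]
      exact deriv.scomp y ((hfm m).differentiable (by simp) _) (hψ.differentiable (by simp) _)
    have hψ' : ContDiff ℝ (⊤ : ℕ∞) (deriv ψ) := hψ.iterate_deriv 1
    have hL := norm_iteratedFDeriv_smul_le (𝕜 := ℝ) (N := ((⊤ : ℕ∞) : WithTop ℕ∞)) hψ'
      ((hfm (m + 1)).comp hψ) (x := x) (n := k) (by exact_mod_cast le_top)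
    simp only [norm_iteratedFDeriv_eq_norm_iteratedDeriv] at hL
    rw [iteratedDeriv_succ', hder]
    refine hL.trans ?_
    have hterm : ∀ i ∈ Finset.range (k + 1),
        (k.choose i : ℝ) * ‖iteratedDeriv i (deriv ψ) x‖ *
          ‖iteratedDeriv (k - i) (iteratedDeriv (m + 1) f ∘ ψ) x‖ ≤
        c * (D⁻¹ ^ m * M (m + (k + 1))) * 2 ^ (k - i) := by
      intro i hi
      have hik : i ≤ k := Nat.lt_succ_iff.1 (Finset.mem_range.1 hi)
      have h1 : ‖iteratedDeriv i (deriv ψ) x‖ ≤ D * M i := by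
        rw [← iteratedDeriv_succ']
        exact hψx i
      have h2 := ih (k - i) (by omega) (m + 1)
      have h3 : (k.choose i : ℝ) * (M i * M (m + 1 + (k - i))) ≤ M (m + (k + 1)) := by
        have h4 := hM i (m + 1 + (k - i))
        rw [show i + (m + 1 + (k - i)) = m + (k + 1) by omega] at h4
        refine le_trans ?_ h4
        have h5 : (k.choose i : ℝ) ≤ (m + (k + 1)).choose i := by
          exact_mod_cast Nat.choose_le_choose i (by omega)
        exact mul_le_mul_of_nonneg_right h5 (mul_nonneg (hM0 _) (hM0 _))
      calc _ ≤ (k.choose i : ℝ) * (D * M i) *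
            (c * (D⁻¹ ^ (m + 1) * 2 ^ (k - i) * M (m + 1 + (k - i)))) := by
            have := hM0 i
            exact mul_le_mul (by gcongr) h2 (norm_nonneg _) (by positivity)
        _ = c * D⁻¹ ^ m * 2 ^ (k - i) * ((k.choose i : ℝ) * (M i * M (m + 1 + (k - i)))) := by
            rw [pow_succ]
            field_simp
        _ ≤ c * D⁻¹ ^ m * 2 ^ (k - i) * M (m + (k + 1)) := by gcongr
        _ = _ := by ring
    refine (Finset.sum_le_sum hterm).trans ?_
    rw [← Finset.mul_sum]
    have hgeom : ∑ i ∈ Finset.range (k + 1), (2 : ℝ) ^ (k - i) ≤ 2 ^ (k + 1) := by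
      have h := Finset.sum_range_reflect (fun i => (2 : ℝ) ^ i) (k + 1)
      simp only [Nat.add_sub_cancel] at h
      rw [h, geom_sum_eq (by norm_num)]
      norm_num
    have := hM0 (m + (k + 1))
    calc _ ≤ c * (D⁻¹ ^ m * M (m + (k + 1))) * 2 ^ (k + 1) := by gcongr
      _ = _ := by ring

/-- if `ψ(x) = Ax + θ(x)` with `A ≠ 0`, `θ' ∈ B_{L∞,ω}(ℝ)`,
`|θ(x)| = O(|x|^a)` for some `a ∈ [0,1)` and `ω(x^a) = o(ω(x))`, then the
composition operator `C_ψ : S_ω(ℝ) → S_ω(ℝ)` is well defined. -/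
theorem stmt14 (ω : ℝ → ℝ) (hω : IsWeightFunction ω)
    (A : ℝ) (hA : A ≠ 0) (a : ℝ) (ha0 : 0 ≤ a) (ha1 : a < 1)
    (θ : ℝ → ℝ) (hθ : ContDiff ℝ (⊤ : ℕ∞) θ)
    (hθ' : ∀ ℓ : ℕ, 1 ≤ ℓ → ∃ B > 0, ∀ k : ℕ, 1 ≤ k → ∀ x : ℝ,
      |iteratedDeriv k θ x| ≤ B * Real.exp ((ℓ : ℝ) * youngConj ω ((k : ℝ) / ℓ)))
    (hθa : ∃ C₀ > 0, ∀ x : ℝ, |θ x| ≤ C₀ * (1 + |x|) ^ a)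
    (hωa : (fun x : ℝ => ω (x ^ a)) =o[Filter.atTop] ω)
    (f : ℝ → ℂ) (hf : InSomega ω f) :
    InSomega ω (fun x => f (A * x + θ x)) := by
  obtain ⟨C₀, hC₀, hθC⟩ := hθa
  obtain ⟨hfs, hfb⟩ := hf
  have hψs : ContDiff ℝ (⊤ : ℕ∞) (fun x => A * x + θ x) := by fun_prop
  refine ⟨hfs.comp hψs, fun lam hlam mu hmu => ?_⟩
  obtain ⟨n, hn, K, hK, hxψ⟩ := exists_abs_le_of_sublinear hA ha1 hC₀ hθC
  obtain ⟨l, hl⟩ := exists_nat_ge (2 * lam + 1)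
  have hl1 : 1 ≤ l := by
    have : (1 : ℝ) ≤ l := by linarith
    exact_mod_cast this
  obtain ⟨B, hB, hθB⟩ := hθ' l hl1
  obtain ⟨L, hL, hsucc⟩ := hω.exists_weightSeq_succ_le (show 0 < 2 * lam by linarith) hl
  set M : ℕ → ℝ := weightSeq ω (2 * lam) with hMdef
  have hM : ∀ k, 0 < M k := weightSeq_pos ω (2 * lam)
  obtain ⟨D, hD⟩ := exists_nat_ge (1 + B * L + |A| / M 0)
  have hD1 : (1 : ℝ) ≤ D := by
    have := hM 0
    have : 0 ≤ B * L + |A| / M 0 := by positivity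
    linarith
  have hθj : ∀ (j : ℕ) (x : ℝ), |iteratedDeriv (j + 1) θ x| ≤ B * L * M j := fun j x =>
    calc _ ≤ B * weightSeq ω l (j + 1) := hθB (j + 1) (by omega) x
      _ ≤ B * (L * M j) := by gcongr; exact hsucc j
      _ = _ := by ring
  have hψj : ∀ (j : ℕ) (x : ℝ),
      ‖iteratedDeriv (j + 1) (fun y => A * y + θ y) x‖ ≤ D * M j := by
    intro j x
    have hd : deriv (fun y => A * y + θ y) = fun y => A + deriv θ y := by
      funext y
      have h1 : HasDerivAt (fun y => A * y) A y := by simpa using (hasDerivAt_id y).const_mul A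
      exact (h1.add (hθ.differentiable (by simp) y).hasDerivAt).deriv
    have hMj := hM j
    have hM0 := hM 0
    have hθx := hθj j x
    rw [iteratedDeriv_succ'] at hθx ⊢
    rw [hd]
    cases j with
    | zero =>
      simp only [iteratedDeriv_zero] at hθx ⊢
      calc ‖A + deriv θ x‖ ≤ |A| + |deriv θ x| := norm_add_le _ _
        _ ≤ |A| + B * L * M 0 := by gcongr
        _ = (B * L + |A| / M 0) * M 0 := by field_simp; ring
        _ ≤ D * M 0 := by gcongr; linarith
    | succ j =>
      rw [iteratedDeriv_succ', deriv_const_add', ← iteratedDeriv_succ', Real.norm_eq_abs]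
      refine hθx.trans ?_
      have : 0 ≤ |A| / M 0 := by positivity
      gcongr
      linarith
  obtain ⟨C, hC⟩ := hfb (D * (2 * lam)) (by positivity) (mu * n) (by positivity)
  have hC0 : 0 ≤ C := by
    have h := (norm_nonneg _).trans (hC 0 0)
    exact nonneg_of_mul_nonneg_left h (Real.exp_pos _)
  refine ⟨C * Real.exp (mu * ω K), fun k x => ?_⟩
  set y := A * x + θ x with hy
  have hfx : ∀ m, ‖iteratedDeriv m f y‖ ≤
      C * Real.exp (-(mu * n * ω |y|)) * ((D : ℝ)⁻¹ ^ m * M m) := by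
    intro m
    have h := hC m y
    rw [sub_eq_add_neg, Real.exp_add] at h
    have h2 := hω.pow_mul_weightSeq_le (show 0 < 2 * lam by linarith)
      (show 1 ≤ D by exact_mod_cast hD1) m
    have h3 : weightSeq ω (D * (2 * lam)) m ≤ (D : ℝ)⁻¹ ^ m * M m := by
      rw [inv_pow, inv_mul_eq_div, le_div_iff₀ (by positivity), mul_comm]
      exact h2
    calc _ ≤ C * (weightSeq ω (D * (2 * lam)) m * Real.exp (-(mu * n * ω |y|))) := h
      _ ≤ C * ((D : ℝ)⁻¹ ^ m * M m * Real.exp (-(mu * n * ω |y|))) := by gcongr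
      _ = _ := by ring
  have hmain := norm_iteratedDeriv_comp_le_of_weight hfs hψs (fun k => (hM k).le)
    (hω.choose_mul_weightSeq_le (show 0 < 2 * lam by linarith)) (show (0 : ℝ) < D by linarith)
    (show 0 ≤ C * Real.exp (-(mu * n * ω |y|)) by positivity) hfx (fun j => hψj j x) k 0
  simp only [iteratedDeriv_zero, pow_zero, one_mul, zero_add] at hmain
  have h2 : 2 ^ k * M k ≤ weightSeq ω lam k := by
    simpa using hω.pow_mul_weightSeq_le hlam (n := 2) (by norm_num) k
  have hdecay : ω |x| ≤ n * ω |y| + ω K := by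
    have h3 : ω |x| ≤ ω (n * |y| + K) :=
      hω.monotone (Set.mem_Ici.2 (abs_nonneg x)) (Set.mem_Ici.2 (by positivity)) (hxψ x)
    have h4 := hω.subadditive (n * |y|) K (by positivity) hK
    have h5 := hω.natCast_mul_le hn (abs_nonneg y)
    linarith
  have h6 : Real.exp (-(mu * n * ω |y|)) ≤ Real.exp (mu * ω K) * Real.exp (-(mu * ω |x|)) := by
    rw [← Real.exp_add]
    have := mul_le_mul_of_nonneg_left hdecay hmu.le
    exact Real.exp_le_exp.2 (by linarith)
  refine hmain.trans ?_
  rw [sub_eq_add_neg, Real.exp_add]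
  have := hM k
  calc C * Real.exp (-(mu * n * ω |y|)) * (2 ^ k * M k)
      ≤ C * (Real.exp (mu * ω K) * Real.exp (-(mu * ω |x|))) * weightSeq ω lam k := by gcongr
    _ = C * Real.exp (mu * ω K) * (weightSeq ω lam k * Real.exp (-(mu * ω |x|))) := by ring
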